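/- arXiv:2502.05862 — 4 statements merged into one kernel-verified Lean document; each statement's English description precedes it below -/
import Mathlib

section
/- Let ρ be a critical radius function on ℝ^n, θ ≥ 0, 0 ≤ α < n, 1 ≤ p < ∞ and p ≤ q < ∞, and let μ, ν be weights. If there is a constant c > 0 such that ‖M_α^{ρ,θ}f‖_{L^{q,∞}(ν)} ≤ c‖f‖_{L^{p,1}(μ)} for every measurable function f, then (μ,ν) ∈ A_{p,q,α}^{ρ,θ,R}, and moreover [μ,ν]_{A_{p,q,α}^{ρ,θ,R}} ≤ p·c. -/
open MeasureTheory ENNReal Set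
noncomputable section

/-- `ℝ^n` with the Euclidean norm. -/
abbrev Rn (n : ℕ) := EuclideanSpace ℝ (Fin n)

/-- The cube of center `c` and side length `r`. -/
def cube {n : ℕ} (c : Rn n) (r : ℝ) : Set (Rn n) := {y | ∀ i, |y i - c i| ≤ r / 2}

/-- `ψ_θ(Q) = (1 + r_Q/ρ(x_Q))^θ` for the cube `Q` of center `c` and side length `r`. -/
def psi {n : ℕ} (ρ : Rn n → ℝ) (θ : ℝ) (c : Rn n) (r : ℝ) : ℝ := (1 + r / ρ c) ^ θ

/-- `ρ` is a critical radius function with constants `C₀, N₀`. -/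
def IsCriticalRadiusWith {n : ℕ} (ρ : Rn n → ℝ) (C₀ N₀ : ℝ) : Prop :=
  0 < C₀ ∧ 0 < N₀ ∧ (∀ x, 0 < ρ x) ∧ ∀ x y : Rn n,
    C₀⁻¹ * ρ x * (1 + ‖x - y‖ / ρ x) ^ (-N₀) ≤ ρ y ∧
    ρ y ≤ C₀ * ρ x * (1 + ‖x - y‖ / ρ x) ^ (N₀ / (N₀ + 1))

/-- `ρ` is a critical radius function. -/
def IsCriticalRadius {n : ℕ} (ρ : Rn n → ℝ) : Prop := ∃ C₀ N₀, IsCriticalRadiusWith ρ C₀ N₀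

/-- A weight: locally integrable and a.e. positive. -/
def IsWeight {n : ℕ} (w : Rn n → ℝ) : Prop :=
  LocallyIntegrable w (volume : Measure (Rn n)) ∧ ∀ᵐ x : Rn n, 0 < w x

/-- `w(S) = ∫_S w`. -/
def wMeas {n : ℕ} (w : Rn n → ℝ) (S : Set (Rn n)) : ℝ≥0∞ :=
  ∫⁻ x in S, ENNReal.ofReal (w x)

/-- Fractional maximal operator `M_α^{ρ,θ}` associated with the critical radius function `ρ`. -/
def fracMax (n : ℕ) (ρ : Rn n → ℝ) (θ α : ℝ) (f : Rn n → ℝ) (x : Rn n) : ℝ≥0∞ :=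
  ⨆ (c : Rn n) (r : ℝ) (_ : 0 < r) (_ : x ∈ cube c r),
    ENNReal.ofReal ((psi ρ θ c r * r ^ n) ^ (α / n - 1)) *
      ∫⁻ y in cube c r, ENNReal.ofReal |f y|

/-- The Lorentz `L^{p,1}(w)` norm. -/
def lorentzP1 {n : ℕ} (p : ℝ) (w : Rn n → ℝ) (f : Rn n → ℝ) : ℝ≥0∞ :=
  ENNReal.ofReal p * ∫⁻ y in Ioi (0 : ℝ), (wMeas w {x | y < |f x|}) ^ (1 / p)

/-- The weak `L^{q,∞}(w)` quasi-norm of an `ℝ≥0∞`-valued function. -/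
def weakNormE {n : ℕ} (q : ℝ) (w : Rn n → ℝ) (F : Rn n → ℝ≥0∞) : ℝ≥0∞ :=
  ⨆ (l : ℝ) (_ : 0 < l), ENNReal.ofReal l * (wMeas w {x | ENNReal.ofReal l < F x}) ^ (1 / q)

/-- The weak `L^{q,∞}(w)` quasi-norm of a real function, with `q = ∞` allowed
(in which case it is the `w`-essential supremum). -/
def weakNormR {n : ℕ} (q : ℝ≥0∞) (w : Rn n → ℝ) (f : Rn n → ℝ) : ℝ≥0∞ :=
  if q = ∞ then
    essSup (fun x => ENNReal.ofReal |f x|)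
      ((volume : Measure (Rn n)).withDensity fun x => ENNReal.ofReal (w x))
  else ⨆ (l : ℝ) (_ : 0 < l), ENNReal.ofReal l * (wMeas w {x | l < |f x|}) ^ (1 / q.toReal)

/-- The conjugate exponent `p' = p/(p-1)` (with `1' = ∞`), as an extended real number. -/
def conjE (p : ℝ) : ℝ≥0∞ := if p = 1 then ∞ else ENNReal.ofReal (p / (p - 1))

/-- The constant `[μ,ν]_{A_{p,q,α}^{ρ,θ,R}}`. -/
def ApqR {n : ℕ} (ρ : Rn n → ℝ) (θ α p q : ℝ) (μ ν : Rn n → ℝ) : ℝ≥0∞ :=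
  ⨆ (c : Rn n) (r : ℝ) (_ : 0 < r),
    (wMeas ν (cube c r)) ^ (1 / q) *
      weakNormR (conjE p) μ ((cube c r).indicator fun x => (μ x)⁻¹) *
      ENNReal.ofReal ((r ^ n * psi ρ θ c r) ^ (α / n - 1))

/-- The constant `‖μ,ν‖_{A_{p,q,α}^{ρ,θ,R}}`. -/
def normApqR {n : ℕ} (ρ : Rn n → ℝ) (θ α p q : ℝ) (μ ν : Rn n → ℝ) : ℝ≥0∞ :=
  ⨆ (c : Rn n) (r : ℝ) (_ : 0 < r),
    (wMeas ν (cube c r)) ^ (1 / q) *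
      ⨆ (P : Set (Rn n)) (_ : MeasurableSet P) (_ : 0 < wMeas μ P) (_ : wMeas μ P ≠ ∞),
        volume (P ∩ cube c r) * ENNReal.ofReal ((r ^ n * psi ρ θ c r) ^ (α / n - 1)) *
          (wMeas μ P) ^ (-(1 / p))

/-- The constant `[w]_{A_p^{ρ,σ}}` (for `1 < p < ∞`). -/
def ApC {n : ℕ} (ρ : Rn n → ℝ) (σ p : ℝ) (w : Rn n → ℝ) : ℝ≥0∞ :=
  ⨆ (c : Rn n) (r : ℝ) (_ : 0 < r),
    (ENNReal.ofReal (psi ρ σ c r))⁻¹ *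
      ((ENNReal.ofReal (r ^ n))⁻¹ * wMeas w (cube c r)) *
      ((ENNReal.ofReal (r ^ n))⁻¹ *
        ∫⁻ y in cube c r, ENNReal.ofReal (w y ^ (1 - p / (p - 1)))) ^ (p - 1)
/-- The heat semigroup `e^{tΔ}` on `ℝ^n`. -/
def heatSg (n : ℕ) (t : ℝ) (g : Rn n → ℝ) (x : Rn n) : ℝ :=
  ∫ y : Rn n, (4 * Real.pi * t) ^ (-(n : ℝ) / 2) * Real.exp (-‖x - y‖ ^ 2 / (4 * t)) * g y

/-- The `ϱ`-variation operator of the classical heat semigroup. -/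
def varHeat (n : ℕ) (ϱ : ℝ) (g : Rn n → ℝ) (x : Rn n) : ℝ≥0∞ :=
  ⨆ (t : ℕ → ℝ) (_ : StrictAnti t) (_ : ∀ j, 0 < t j)
      (_ : Filter.Tendsto t Filter.atTop (nhds 0)),
    (∑' j : ℕ, ENNReal.ofReal (|heatSg n (t j) g x - heatSg n (t (j + 1)) g x| ^ ϱ)) ^ (1 / ϱ)

/-- Muckenhoupt `A₁`. -/
def IsA1 {n : ℕ} (w : Rn n → ℝ) : Prop :=
  ∃ C > (0 : ℝ), ∀ (c : Rn n) (r : ℝ), 0 < r →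
    wMeas w (cube c r) ≤ ENNReal.ofReal C * ENNReal.ofReal (r ^ n) *
      essInf (fun x => ENNReal.ofReal (w x)) (volume.restrict (cube c r))

/-- Muckenhoupt `A_p`, `1 < p < ∞`. -/
def IsAp {n : ℕ} (p : ℝ) (w : Rn n → ℝ) : Prop :=
  ∃ C > (0 : ℝ), ∀ (c : Rn n) (r : ℝ), 0 < r →
    wMeas w (cube c r) *
      (∫⁻ y in cube c r, ENNReal.ofReal (w y ^ (1 - p / (p - 1)))) ^ (p - 1) ≤
      ENNReal.ofReal C * (ENNReal.ofReal (r ^ n)) ^ p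

/-- Muckenhoupt `A_∞ = ∪_{p ≥ 1} A_p`. -/
def IsAinfty {n : ℕ} (w : Rn n → ℝ) : Prop := IsA1 w ∨ ∃ p > (1 : ℝ), IsAp p w

/-- The class `A₁^{ρ,loc}`, with the `A₁` condition over balls `B(x,r)`, `r ≤ ρ(x)`. -/
def IsA1loc {n : ℕ} (ρ : Rn n → ℝ) (w : Rn n → ℝ) : Prop :=
  ∃ C > (0 : ℝ), ∀ (x : Rn n) (r : ℝ), 0 < r → r ≤ ρ x →
    wMeas w (Metric.ball x r) ≤ ENNReal.ofReal C * volume (Metric.ball x r) *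
      essInf (fun y => ENNReal.ofReal (w y)) (volume.restrict (Metric.ball x r))

/-- The class `A_p^{ρ,loc}` for `1 < p < ∞`. -/
def IsAploc {n : ℕ} (ρ : Rn n → ℝ) (p : ℝ) (w : Rn n → ℝ) : Prop :=
  ∃ C > (0 : ℝ), ∀ (x : Rn n) (r : ℝ), 0 < r → r ≤ ρ x →
    wMeas w (Metric.ball x r) *
      (∫⁻ y in Metric.ball x r, ENNReal.ofReal (w y ^ (1 - p / (p - 1)))) ^ (p - 1) ≤
      ENNReal.ofReal C * (volume (Metric.ball x r)) ^ p

/-- `A_∞^{ρ,loc} = ∪_{p ≥ 1} A_p^{ρ,loc}`. -/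
def IsAinfLoc {n : ℕ} (ρ : Rn n → ℝ) (w : Rn n → ℝ) : Prop :=
  IsA1loc ρ w ∨ ∃ p > (1 : ℝ), IsAploc ρ p w

/-- The class `A₁^{ρ,θ}`. -/
def IsA1rho {n : ℕ} (ρ : Rn n → ℝ) (θ : ℝ) (w : Rn n → ℝ) : Prop :=
  ∃ C > (0 : ℝ), ∀ (c : Rn n) (r : ℝ), 0 < r →
    wMeas w (cube c r) ≤ ENNReal.ofReal (C * (psi ρ θ c r * r ^ n)) *
      essInf (fun x => ENNReal.ofReal (w x)) (volume.restrict (cube c r))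

/-- The class `A_∞^ρ(μ)`. -/
def IsAinfRhoMu {n : ℕ} (ρ : Rn n → ℝ) (μ w : Rn n → ℝ) : Prop :=
  ∃ θ ≥ (0 : ℝ), ∃ ε > (0 : ℝ), ∃ C > (0 : ℝ), ∀ (c : Rn n) (r : ℝ), 0 < r →
    ∀ E ⊆ cube c r, MeasurableSet E →
      wMeas (fun x => w x * μ x) E ≤ ENNReal.ofReal (C * psi ρ θ c r) *
        (wMeas μ E / wMeas μ (cube c r)) ^ ε * wMeas (fun x => w x * μ x) (cube c r)

/-- The class `A_∞^ρ`. -/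
def IsAinfRho {n : ℕ} (ρ : Rn n → ℝ) (w : Rn n → ℝ) : Prop :=
  ∃ θ ≥ (0 : ℝ), ∃ δ > (0 : ℝ), ∃ C > (0 : ℝ), ∀ (c : Rn n) (r : ℝ), 0 < r →
    ∀ E ⊆ cube c r, MeasurableSet E →
      wMeas w E ≤ ENNReal.ofReal (C * psi ρ θ c r) *
        (volume E / ENNReal.ofReal (r ^ n)) ^ δ * wMeas w (cube c r)

/-- Membership in `RH_∞^{ρ,θ}` with constant `C`. -/
def IsRHinf {n : ℕ} (ρ : Rn n → ℝ) (θ : ℝ) (w : Rn n → ℝ) (C : ℝ) : Prop :=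
  ∀ (c : Rn n) (r : ℝ), 0 < r →
    essSup (fun x => ENNReal.ofReal (w x)) (volume.restrict (cube c r)) ≤
      ENNReal.ofReal (C * psi ρ θ c r) * ((ENNReal.ofReal (r ^ n))⁻¹ * wMeas w (cube c r))

/-- An `η`-sparse family of cubes, encoded by their (center, side length) data. -/
def IsSparse {n : ℕ} (η : ℝ) (S : Set (Rn n × ℝ)) : Prop :=
  S.Countable ∧ (∀ Q ∈ S, 0 < Q.2) ∧
  ∃ E : Rn n × ℝ → Set (Rn n),
    (∀ Q ∈ S, MeasurableSet (E Q) ∧ E Q ⊆ cube Q.1 Q.2 ∧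
      ENNReal.ofReal η * volume (cube Q.1 Q.2) ≤ volume (E Q)) ∧
    S.PairwiseDisjoint E

/-- The sparse operator `A_S^{ρ,N}`. -/
def sparseOp {n : ℕ} (ρ : Rn n → ℝ) (N : ℝ) (S : Set (Rn n × ℝ)) (f : Rn n → ℝ)
    (x : Rn n) : ℝ≥0∞ :=
  ∑' Q : S, (cube (Q : Rn n × ℝ).1 (Q : Rn n × ℝ).2).indicator
    (fun _ => (ENNReal.ofReal ((3 * (Q : Rn n × ℝ).2) ^ n))⁻¹ *
      (∫⁻ y in cube (Q : Rn n × ℝ).1 (3 * (Q : Rn n × ℝ).2), ENNReal.ofReal |f y|) *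
      (ENNReal.ofReal (psi ρ N (Q : Rn n × ℝ).1 (Q : Rn n × ℝ).2))⁻¹) x

lemma wMeas_mono {n : ℕ} (w : Rn n → ℝ) {S T : Set (Rn n)} (h : S ⊆ T) :
    wMeas w S ≤ wMeas w T :=
  lintegral_mono_set h

/-- The Lorentz norm of the indicator of a set is at most `p * w(P)^{1/p}`. -/
lemma lorentzP1_indicator_le {n : ℕ} {p : ℝ} (hp : 0 < p) (w : Rn n → ℝ) (P : Set (Rn n)) :
    lorentzP1 p w (P.indicator fun _ => (1 : ℝ)) ≤ ENNReal.ofReal p * wMeas w P ^ (1 / p) := by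
  unfold lorentzP1
  gcongr
  have hpt : ∀ y ∈ Ioi (0 : ℝ),
      wMeas w {x | y < |P.indicator (fun _ => (1 : ℝ)) x|} ^ (1 / p) ≤
        (Ioc (0 : ℝ) 1).indicator (fun _ => wMeas w P ^ (1 / p)) y := by
    intro y hy
    rw [mem_Ioi] at hy
    by_cases h1 : y ≤ 1
    · rw [indicator_of_mem (show y ∈ Ioc (0 : ℝ) 1 from ⟨hy, h1⟩)]
      refine ENNReal.rpow_le_rpow (wMeas_mono w fun x hx => ?_) (by positivity)
      by_contra hxP
      simp only [mem_ofPred_eq, indicator_of_notMem hxP, abs_zero] at hx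
      linarith
    · have hempty : {x | y < |P.indicator (fun _ => (1 : ℝ)) x|} = ∅ := by
        ext x
        by_cases hxP : x ∈ P <;> simp [hxP] <;> linarith
      simp [hempty, wMeas, hp]
  calc _ ≤ ∫⁻ y in Ioi (0 : ℝ), (Ioc (0 : ℝ) 1).indicator (fun _ => wMeas w P ^ (1 / p)) y :=
        setLIntegral_mono' measurableSet_Ioi hpt
    _ ≤ ∫⁻ y, (Ioc (0 : ℝ) 1).indicator (fun _ => wMeas w P ^ (1 / p)) y :=
        setLIntegral_le_lintegral _ _
    _ = wMeas w P ^ (1 / p) := by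
        rw [lintegral_indicator measurableSet_Ioc]; simp

lemma mul_rpow_le_weakNormE {n : ℕ} {q : ℝ} (hq : 0 < q) (w : Rn n → ℝ) {F : Rn n → ℝ≥0∞}
    {S : Set (Rn n)} {a : ℝ≥0∞} (h : ∀ x ∈ S, a ≤ F x) :
    a * wMeas w S ^ (1 / q) ≤ weakNormE q w F := by
  refine ENNReal.mul_le_of_forall_lt fun a' ha' b' hb' => ?_
  rcases eq_or_ne a' 0 with rfl | h0
  · simp
  have htop : a' ≠ ∞ := ha'.ne_top
  refine le_trans ?_ (le_iSup₂ (f := fun (l : ℝ) (_ : 0 < l) =>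
    ENNReal.ofReal l * (wMeas w {x | ENNReal.ofReal l < F x}) ^ (1 / q)) a'.toReal
    (ENNReal.toReal_pos h0 htop))
  rw [ENNReal.ofReal_toReal htop]
  gcongr
  refine hb'.le.trans (ENNReal.rpow_le_rpow (wMeas_mono w fun x hx => ?_) (by positivity))
  exact ha'.trans_le (h x hx)

/-- Testing a restricted weak-type bound for the maximal operator on subsets of a cube. -/
lemma volume_mul_rpow_le_of_restricted_bound {n : ℕ} {ρ : Rn n → ℝ} {θ α p q C : ℝ}
    (hp : 0 < p) (hq : 0 < q) {μ ν : Rn n → ℝ}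
    (hbd : ∀ f : Rn n → ℝ, Measurable f →
      weakNormE q ν (fracMax n ρ θ α f) ≤ ENNReal.ofReal C * lorentzP1 p μ f)
    (c : Rn n) {r : ℝ} (hr : 0 < r) {P : Set (Rn n)}
    (hP : NullMeasurableSet P) (hPQ : P ⊆ cube c r) :
    ENNReal.ofReal ((psi ρ θ c r * r ^ n) ^ (α / n - 1)) * volume P *
        wMeas ν (cube c r) ^ (1 / q) ≤
      ENNReal.ofReal C * (ENNReal.ofReal p * wMeas μ P ^ (1 / p)) := by
  obtain ⟨T, hTP, hT, hae⟩ := hP.exists_measurable_subset_ae_eq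
  rw [← measure_congr hae]
  calc _ ≤ weakNormE q ν (fracMax n ρ θ α (T.indicator fun _ => (1 : ℝ))) := by
        refine mul_rpow_le_weakNormE hq ν fun x hx => ?_
        unfold fracMax
        refine le_iSup_of_le c (le_iSup_of_le r (le_iSup_of_le hr (le_iSup_of_le hx ?_)))
        gcongr
        have : ∀ y, ENNReal.ofReal |T.indicator (fun _ => (1 : ℝ)) y| =
            T.indicator (fun _ => (1 : ℝ≥0∞)) y := by
          intro y
          by_cases hy : y ∈ T <;> simp [hy]
        simp_rw [this]
        rw [lintegral_indicator_const hT, one_mul, Measure.restrict_apply hT,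
          inter_eq_left.mpr (hTP.trans hPQ)]
    _ ≤ _ := hbd _ (measurable_const.indicator hT)
    _ ≤ _ := by
        gcongr
        refine (lorentzP1_indicator_le hp μ T).trans ?_
        gcongr
        exact wMeas_mono μ hTP

lemma isClosed_cube {n : ℕ} (c : Rn n) (r : ℝ) : IsClosed (cube c r) := by
  simp only [cube, ofPred_forall]
  exact isClosed_iInter fun i => isClosed_le (by fun_prop) continuous_const

lemma volume_cube_lt_top {n : ℕ} (c : Rn n) (r : ℝ) : volume (cube c r) < ∞ := by
  have : cube c r ⊆ (WithLp.ofLp : Rn n → Fin n → ℝ) ⁻¹'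
      (Icc (fun i => c i - r / 2) fun i => c i + r / 2) := by
    intro y hy
    refine ⟨fun i => ?_, fun i => ?_⟩ <;> have := abs_le.mp (hy i) <;> simp <;> linarith
  refine (measure_mono this).trans_lt ?_
  rw [(PiLp.volume_preserving_ofLp (Fin n)).measure_preimage
    measurableSet_Icc.nullMeasurableSet]
  exact isCompact_Icc.measure_lt_top

lemma mul_wMeas_inv_level_le {n : ℕ} {w : Rn n → ℝ} {Q : Set (Rn n)} {t : ℝ} (ht : 0 < t) :
    ENNReal.ofReal t * wMeas w {x | t < |Q.indicator (fun x => (w x)⁻¹) x|} ≤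
      volume {x | t < |Q.indicator (fun x => (w x)⁻¹) x|} := by
  set P := {x | t < |Q.indicator (fun x => (w x)⁻¹) x|}
  have hpt : ∀ x ∈ P, ENNReal.ofReal (w x) ≤ (ENNReal.ofReal t)⁻¹ := by
    intro x hx
    have hxt : t < |Q.indicator (fun x => (w x)⁻¹) x| := hx
    by_cases hxQ : x ∈ Q
    · rw [indicator_of_mem hxQ, abs_inv] at hxt
      rw [← ENNReal.ofReal_inv_of_pos ht]
      have h0 : 0 < |w x| := inv_pos.mp (ht.trans hxt)
      exact ENNReal.ofReal_le_ofReal ((le_abs_self _).trans ((lt_inv_comm₀ ht h0).mp hxt).le)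
    · rw [indicator_of_notMem hxQ, abs_zero] at hxt
      linarith
  have hle : wMeas w P ≤ (ENNReal.ofReal t)⁻¹ * volume P := by
    refine (setLIntegral_mono measurable_const hpt).trans_eq ?_
    rw [setLIntegral_const]
  calc _ ≤ ENNReal.ofReal t * ((ENNReal.ofReal t)⁻¹ * volume P) := by gcongr
    _ = volume P := by
      rw [← mul_assoc, ENNReal.mul_inv_cancel (by simpa using ht) ENNReal.ofReal_ne_top, one_mul]

lemma inv_level_subset {n : ℕ} (w : Rn n → ℝ) (Q : Set (Rn n)) {t : ℝ} (ht : 0 < t) :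
    {x | t < |Q.indicator (fun x => (w x)⁻¹) x|} ⊆ Q := by
  intro x hx
  by_contra hxQ
  simp only [mem_ofPred_eq, indicator_of_notMem hxQ, abs_zero] at hx
  linarith

lemma nullMeasurableSet_inv_level {n : ℕ} {w : Rn n → ℝ} (hw : IsWeight w) {Q : Set (Rn n)}
    (hQ : MeasurableSet Q) (t : ℝ) :
    NullMeasurableSet {x | t < |Q.indicator (fun x => (w x)⁻¹) x|} := by
  have hm : AEMeasurable w volume := hw.1.aestronglyMeasurable.aemeasurable
  have hm' : AEMeasurable (fun x => |Q.indicator (fun x => (w x)⁻¹) x|) volume :=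
    (hm.inv.indicator hQ).norm
  exact nullMeasurableSet_lt aemeasurable_const hm'

lemma ENNReal.mul_rpow_one_sub_le {t m B K : ℝ≥0∞} {s : ℝ} (h0 : m ≠ 0) (htop : m ≠ ∞)
    (h : t * m * B ≤ K * m ^ s) : t * m ^ (1 - s) * B ≤ K := by
  have hs0 : m ^ s ≠ 0 := (ENNReal.rpow_pos (pos_iff_ne_zero.mpr h0) htop).ne'
  have hst : m ^ s ≠ ∞ := ENNReal.rpow_ne_top_of_ne_zero h0 htop
  rw [← ENNReal.mul_le_mul_iff_left hs0 hst]
  calc t * m ^ (1 - s) * B * m ^ s = t * (m ^ (1 - s) * m ^ s) * B := by ring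
    _ = t * m * B := by rw [← ENNReal.rpow_add _ _ h0 htop, sub_add_cancel, ENNReal.rpow_one]
    _ ≤ _ := h

/-- A bound at every level of positive measure controls the weak `L^{p'}` quasi-norm. -/
lemma mul_weakNormR_conjE_le {n : ℕ} {p : ℝ} (hp : 1 ≤ p) (w f : Rn n → ℝ) {B K : ℝ≥0∞}
    (h : ∀ t : ℝ, 0 < t → wMeas w {x | t < |f x|} ≠ 0 →
      ENNReal.ofReal t * wMeas w {x | t < |f x|} ^ (1 - 1 / p) * B ≤ K) :
    weakNormR (conjE p) w f * B ≤ K := by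
  rcases hp.eq_or_lt with rfl | hp1
  · simp only [conjE, weakNormR, if_true]
    refine ENNReal.mul_le_of_forall_lt fun a ha b hb => ?_
    obtain ⟨t, hat, ht⟩ := ENNReal.lt_iff_exists_nnreal_btwn.mp ha
    rcases eq_or_ne t 0 with rfl | ht0
    · simp at hat
    have htpos : (0 : ℝ) < t := by positivity
    have hne : wMeas w {x | (t : ℝ) < |f x|} ≠ 0 := by
      intro hz
      refine ht.not_ge (essSup_le_of_ae_le _ ?_)
      rw [wMeas, ← withDensity_apply'] at hz
      filter_upwards [measure_eq_zero_iff_ae_notMem.mp hz] with x hx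
      have hx' : |f x| ≤ t := not_lt.mp hx
      simpa using ENNReal.ofReal_le_ofReal hx'
    have := h t htpos hne
    simp only [div_one, sub_self, ENNReal.rpow_zero, mul_one, ENNReal.ofReal_coe_nnreal] at this
    exact (mul_le_mul' hat.le hb.le).trans this
  · have hexp : 1 / (p / (p - 1)) = 1 - 1 / p := by
      have : p - 1 ≠ 0 := by linarith
      field_simp
    have hpos : 0 < 1 - 1 / p := by
      rw [← hexp]
      have : 0 < p - 1 := by linarith
      positivity
    have hnn : 0 ≤ p / (p - 1) := div_nonneg (by linarith) (by linarith)
    simp only [conjE, weakNormR, if_neg hp1.ne', ENNReal.ofReal_ne_top, if_false,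
      ENNReal.toReal_ofReal hnn, hexp, ENNReal.iSup_mul]
    refine iSup₂_le fun t ht => ?_
    by_cases hz : wMeas w {x | t < |f x|} = 0
    · rw [hz, ENNReal.zero_rpow_of_pos hpos]
      simp
    · exact h t ht hz

/-- If `M_α^{ρ,θ}` maps `L^{p,1}(μ)` to `L^{q,∞}(ν)` with constant `c`,
then `(μ,ν) ∈ A_{p,q,α}^{ρ,θ,R}` with `[μ,ν] ≤ p·c`. -/
theorem statement1 (n : ℕ) (ρ : Rn n → ℝ) (hρ : IsCriticalRadius ρ)
    (θ α p q : ℝ) (hθ : 0 ≤ θ) (hα : 0 ≤ α) (hαn : α < n) (hp : 1 ≤ p) (hpq : p ≤ q)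
    (μ ν : Rn n → ℝ) (hμ : IsWeight μ) (hν : IsWeight ν)
    (c : ℝ) (hc : 0 < c)
    (hbd : ∀ f : Rn n → ℝ, Measurable f →
      weakNormE q ν (fracMax n ρ θ α f) ≤ ENNReal.ofReal c * lorentzP1 p μ f) :
    ApqR ρ θ α p q μ ν ≠ ∞ ∧ ApqR ρ θ α p q μ ν ≤ ENNReal.ofReal (p * c) := by
  have hp0 : 0 < p := by linarith
  have hle : ApqR ρ θ α p q μ ν ≤ ENNReal.ofReal (p * c) := by
    refine iSup_le fun x => iSup₂_le fun r hr => ?_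
    rw [mul_comm (_ ^ (1 / q)), mul_assoc]
    refine mul_weakNormR_conjE_le hp μ _ fun t ht h0 => ?_
    have hsub := inv_level_subset μ (cube x r) ht
    have hlevel := mul_wMeas_inv_level_le (w := μ) (Q := cube x r) ht
    have htest := volume_mul_rpow_le_of_restricted_bound hp0 (by linarith) hbd x hr
      (nullMeasurableSet_inv_level hμ (isClosed_cube x r).measurableSet t) hsub
    set P := {y | t < |(cube x r).indicator (fun y => (μ y)⁻¹) y|}
    refine ENNReal.mul_rpow_one_sub_le h0 (fun htop => ?_) ?_
    · rw [htop, ENNReal.mul_top (by simpa using ht)] at hlevel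
      exact (measure_mono hsub |>.trans_lt (volume_cube_lt_top x r)).not_ge hlevel
    · rw [mul_comm (r ^ n), mul_comm p c, ENNReal.ofReal_mul hc.le, mul_assoc (ENNReal.ofReal c)]
      refine le_trans ?_ htest
      calc _ ≤ volume P * (wMeas ν (cube x r) ^ (1 / q) *
            ENNReal.ofReal ((psi ρ θ x r * r ^ n) ^ (α / n - 1))) := by gcongr
        _ = _ := by ring
  exact ⟨ne_top_of_le_ne_top ENNReal.ofReal_ne_top hle, hle⟩
end
end

section
/- Let ρ be a critical radius function on ℝ^n, θ ≥ 0 and 1 < p < q < ∞. Then for every weight ω one has [ω]_{A_q^{ρ,qθ}} ≤ (p′/(p′−q′))^{q−1}·([ω]_{A_p^{ρ,θ,R}})^q, where p′ = p/(p−1) and q′ = q/(q−1). In particular, every weight in A_p^{ρ,θ,R} belongs to A_q^{ρ,qθ}. -/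
open MeasureTheory ENNReal Set
noncomputable section

/-- A layer-cake bound: on a finite measure space, a weak `L^t` bound controls the `L^s` norm
for `s < t`. -/
theorem lintegral_rpow_le_of_weak_bound {α : Type*} [MeasurableSpace α] (μ : Measure α)
    (f : α → ℝ) (hf0 : ∀ x, 0 ≤ f x) (hfm : AEMeasurable f μ) {s t : ℝ} (hs : 0 < s)
    (hst : s < t) (hμ0 : μ univ ≠ 0) (hμ : μ univ ≠ ∞) (K : ℝ≥0∞) (hK : K ≠ ∞)
    (h : ∀ l : ℝ, 0 < l → ENNReal.ofReal l * (μ {x | l < f x}) ^ (1 / t) ≤ K) :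
    ∫⁻ x, ENNReal.ofReal (f x ^ s) ∂μ ≤
      ENNReal.ofReal (t / (t - s)) * (K ^ s * (μ univ) ^ (1 - s / t)) := by
  have ht : 0 < t := hs.trans hst
  have hts : 0 < t - s := sub_pos.2 hst
  rw [lintegral_rpow_eq_lintegral_meas_lt_mul μ (Filter.Eventually.of_forall hf0) hfm hs]
  have hd : ∀ l : ℝ, 0 < l → μ {x | l < f x} ≤ (K / ENNReal.ofReal l) ^ t := by
    intro l hl
    rw [← ENNReal.rpow_inv_le_iff ht, ENNReal.le_div_iff_mul_le
      (Or.inl (by simpa using hl)) (Or.inl ofReal_ne_top), mul_comm, ← one_div]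
    exact h l hl
  rcases eq_or_ne K 0 with rfl | hK0
  · have : ∫⁻ l in Ioi (0 : ℝ), μ {x | l < f x} * ENNReal.ofReal (l ^ (s - 1)) = 0 := by
      rw [setLIntegral_congr_fun (g := fun _ => 0) measurableSet_Ioi]
      · simp
      · intro l hl
        have h0 := hd l hl
        rw [ENNReal.zero_div, ENNReal.zero_rpow_of_pos ht, nonpos_iff_eq_zero] at h0
        simp [h0]
    simp [this]
  obtain ⟨k, rfl⟩ : ∃ k : ℝ, K = ENNReal.ofReal k := ⟨K.toReal, (ENNReal.ofReal_toReal hK).symm⟩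
  obtain ⟨m, hm⟩ : ∃ m : ℝ, μ univ = ENNReal.ofReal m :=
    ⟨(μ univ).toReal, (ENNReal.ofReal_toReal hμ).symm⟩
  have hk : 0 < k := by simpa using hK0
  have hm0 : 0 < m := by simpa [hm] using hμ0
  set T : ℝ := k * m ^ (-(1 / t)) with hT
  have hT0 : 0 < T := by positivity
  have hlow : ∫⁻ l in Ioc 0 T, μ {x | l < f x} * ENNReal.ofReal (l ^ (s - 1)) ≤
      ENNReal.ofReal (m * (T ^ s / s)) := by
    calc ∫⁻ l in Ioc 0 T, μ {x | l < f x} * ENNReal.ofReal (l ^ (s - 1))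
        ≤ ∫⁻ l in Ioc 0 T, ENNReal.ofReal m * ENNReal.ofReal (l ^ (s - 1)) := by
          refine lintegral_mono fun l => ?_
          gcongr
          exact hm ▸ measure_mono (subset_univ _)
      _ = ENNReal.ofReal m * ENNReal.ofReal (T ^ s / s) := by
          rw [lintegral_const_mul' _ _ ofReal_ne_top, ← ofReal_integral_eq_lintegral_ofReal]
          · rw [← intervalIntegral.integral_of_le hT0.le, integral_rpow (Or.inl (by linarith))]
            simp [Real.zero_rpow hs.ne']
          · exact (intervalIntegral.intervalIntegrable_rpow' (by linarith)).1
          · filter_upwards [ae_restrict_mem measurableSet_Ioc] with l hl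
            exact Real.rpow_nonneg hl.1.le _
      _ = _ := (ENNReal.ofReal_mul hm0.le).symm
  have hhigh : ∫⁻ l in Ioi T, μ {x | l < f x} * ENNReal.ofReal (l ^ (s - 1)) ≤
      ENNReal.ofReal (k ^ t * (T ^ (s - t) / (t - s))) := by
    calc ∫⁻ l in Ioi T, μ {x | l < f x} * ENNReal.ofReal (l ^ (s - 1))
        ≤ ∫⁻ l in Ioi T, ENNReal.ofReal (k ^ t) * ENNReal.ofReal (l ^ (s - t - 1)) := by
          refine setLIntegral_mono' measurableSet_Ioi fun l hl => ?_
          have hl0 : 0 < l := hT0.trans hl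
          refine (mul_le_mul_left (hd l hl0) _).trans_eq ?_
          rw [← ENNReal.ofReal_div_of_pos hl0, ENNReal.ofReal_rpow_of_pos (by positivity),
            ← ENNReal.ofReal_mul (by positivity), ← ENNReal.ofReal_mul (by positivity),
            Real.div_rpow hk.le hl0.le, show s - t - 1 = (s - 1) - t by ring,
            Real.rpow_sub hl0 (s - 1) t]
          congr 1
          ring
      _ = ENNReal.ofReal (k ^ t) * ENNReal.ofReal (T ^ (s - t) / (t - s)) := by
          rw [lintegral_const_mul' _ _ ofReal_ne_top, ← ofReal_integral_eq_lintegral_ofReal]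
          · rw [integral_Ioi_rpow_of_lt (by linarith) hT0, sub_add_cancel, ← neg_sub t s,
              neg_div_neg_eq]
          · exact integrableOn_Ioi_rpow_of_lt (by linarith) hT0
          · filter_upwards [ae_restrict_mem measurableSet_Ioi] with l hl
            exact Real.rpow_nonneg (hT0.trans hl).le _
      _ = _ := (ENNReal.ofReal_mul (by positivity)).symm
  rw [← Ioc_union_Ioi_eq_Ioi hT0.le,
    lintegral_union measurableSet_Ioi (Ioc_disjoint_Ioi le_rfl), hm]
  refine (mul_le_mul_right (add_le_add hlow hhigh) _).trans_eq ?_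
  rw [ENNReal.ofReal_rpow_of_pos hk, ENNReal.ofReal_rpow_of_pos hm0,
    ← ENNReal.ofReal_mul (by positivity), ← ENNReal.ofReal_mul (by positivity),
    ← ENNReal.ofReal_add (by positivity) (by positivity), ← ENNReal.ofReal_mul hs.le]
  have e1 : m * T ^ s = k ^ s * m ^ (1 - s / t) := by
    rw [hT, Real.mul_rpow hk.le (by positivity), ← Real.rpow_mul hm0.le, sub_eq_add_neg,
      Real.rpow_add hm0, Real.rpow_one, show -(1 / t) * s = -(s / t) by ring]
    ring
  have e2 : k ^ t * T ^ (s - t) = k ^ s * m ^ (1 - s / t) := by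
    rw [hT, Real.mul_rpow hk.le (by positivity), ← Real.rpow_mul hm0.le, ← mul_assoc,
      ← Real.rpow_add hk, show t + (s - t) = s by ring,
      show -(1 / t) * (s - t) = 1 - s / t by field_simp; ring]
  congr 1
  rw [← mul_div_assoc, ← mul_div_assoc, e1, e2]
  field_simp
  ring

theorem isCompact_cube {n : ℕ} (c : Rn n) (r : ℝ) : IsCompact (cube c r) := by
  have : cube c r = (EuclideanSpace.equiv (Fin n) ℝ).toHomeomorph ⁻¹'
      Set.pi univ fun i => Metric.closedBall (c i) (r / 2) := by
    ext y
    simp [cube, Real.dist_eq]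
  rw [this, Homeomorph.isCompact_preimage]
  exact isCompact_univ_pi fun i => isCompact_closedBall _ _

theorem wMeas_ne_top {n : ℕ} {w : Rn n → ℝ} (hw : IsWeight w) {S : Set (Rn n)}
    (hS : IsCompact S) : wMeas w S ≠ ∞ :=
  ((hw.1.integrableOn_isCompact hS).lintegral_lt_top).ne

theorem wMeas_inter_eq_withDensity {n : ℕ} (w : Rn n → ℝ) {S : Set (Rn n)}
    (hS : MeasurableSet S) (E : Set (Rn n)) :
    ((volume.restrict S).withDensity fun x => ENNReal.ofReal (w x)) E = wMeas w (E ∩ S) := by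
  rw [withDensity_apply', Measure.restrict_restrict' hS, wMeas]

theorem lintegral_rpow_weight_le {n : ℕ} {w : Rn n → ℝ} (hw : IsWeight w) {S : Set (Rn n)}
    (hS : IsCompact S) (hS0 : wMeas w S ≠ 0) {s t : ℝ} (hs : 0 < s) (hst : s < t)
    (hK : weakNormR (ENNReal.ofReal t) w (S.indicator fun x => (w x)⁻¹) ≠ ∞) :
    ∫⁻ y in S, ENNReal.ofReal (w y ^ (1 - s)) ≤
      ENNReal.ofReal (t / (t - s)) *
        (weakNormR (ENNReal.ofReal t) w (S.indicator fun x => (w x)⁻¹) ^ s *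
          (wMeas w S) ^ (1 - s / t)) := by
  have hSm := hS.measurableSet
  have hwm : AEMeasurable w := hw.1.aestronglyMeasurable.aemeasurable
  set μ := (volume.restrict S).withDensity fun x => ENNReal.ofReal (w x) with hμ
  have hμE := wMeas_inter_eq_withDensity w hSm
  have hμu : μ univ = wMeas w S := by rw [hμE, univ_inter]
  have hfm : AEMeasurable (fun x => |(w x)⁻¹|) (volume.restrict S) :=
    measurable_norm.comp_aemeasurable hwm.inv.restrict
  have key := lintegral_rpow_le_of_weak_bound μ (fun x => |(w x)⁻¹|) (fun _ => abs_nonneg _)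
    (hfm.mono_ac (withDensity_absolutelyContinuous _ _)) hs hst (hμu ▸ hS0)
    (hμu ▸ wMeas_ne_top hw hS) _ hK (by
      intro l hl
      rw [weakNormR, if_neg ofReal_ne_top, ENNReal.toReal_ofReal (hs.trans hst).le, hμE]
      refine le_of_eq_of_le ?_ (le_iSup₂ (f := fun (l : ℝ) (_ : 0 < l) => ENNReal.ofReal l *
        (wMeas w {x | l < |S.indicator (fun x => (w x)⁻¹) x|}) ^ (1 / t)) l hl)
      congr 3
      ext x
      by_cases hx : x ∈ S <;> simp [hx, hl.le])
  rw [hμu] at key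
  refine le_of_eq_of_le ?_ key
  rw [hμ, lintegral_withDensity_eq_lintegral_mul₀ hwm.ennreal_ofReal.restrict
    (hfm.pow_const s).ennreal_ofReal]
  refine lintegral_congr_ae ?_
  filter_upwards [ae_restrict_of_ae hw.2] with x hx
  simp only [Pi.mul_apply]
  rw [← ENNReal.ofReal_mul hx.le, abs_of_pos (inv_pos.2 hx), Real.inv_rpow hx.le,
    Real.rpow_sub hx, Real.rpow_one, div_eq_mul_inv]

/-- `[ω]_{A_q^{ρ,qθ}} ≤ (p'/(p'-q'))^{q-1}·([ω]_{A_p^{ρ,θ,R}})^q`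
for `1 < p < q < ∞`; in particular `A_p^{ρ,θ,R} ⊆ A_q^{ρ,qθ}`. -/
theorem statement5 (n : ℕ) (ρ : Rn n → ℝ) (hρ : IsCriticalRadius ρ)
    (θ p q : ℝ) (hθ : 0 ≤ θ) (hp : 1 < p) (hpq : p < q)
    (ω : Rn n → ℝ) (hω : IsWeight ω) :
    ApC ρ (q * θ) q ω ≤
      ENNReal.ofReal (((p / (p - 1)) / (p / (p - 1) - q / (q - 1))) ^ (q - 1)) *
        (ApqR ρ θ 0 p p ω ω) ^ q ∧
      (ApqR ρ θ 0 p p ω ω ≠ ∞ → ApC ρ (q * θ) q ω ≠ ∞) := by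
  have hp0 : 0 < p := by linarith
  have hp1 : 0 < p - 1 := by linarith
  have hq0 : 0 < q := by linarith
  have hq1 : 0 < q - 1 := by linarith
  have hconj : q / (q - 1) < p / (p - 1) := by
    rw [div_lt_div_iff₀ hq1 hp1]
    nlinarith
  have main : ApC ρ (q * θ) q ω ≤
      ENNReal.ofReal (((p / (p - 1)) / (p / (p - 1) - q / (q - 1))) ^ (q - 1)) *
        (ApqR ρ θ 0 p p ω ω) ^ q := by
    set D := (p / (p - 1)) / (p / (p - 1) - q / (q - 1)) with hD
    have hD0 : 0 < D := div_pos (by positivity) (sub_pos.2 hconj)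
    rcases eq_or_ne (ApqR ρ θ 0 p p ω ω) ∞ with hA | hA
    · rw [hA, ENNReal.top_rpow_of_pos hq0,
        ENNReal.mul_top (by simpa using Real.rpow_pos_of_pos hD0 _)]
      exact le_top
    refine iSup_le fun c => iSup₂_le fun r hr => ?_
    obtain ⟨_, _, _, _, hρ0, _⟩ := hρ
    have hQ := isCompact_cube c r
    set W := wMeas ω (cube c r) with hW
    rcases eq_or_ne W 0 with hW0 | hW0
    · simp [hW0]
    have hWt : W ≠ ∞ := wMeas_ne_top hω hQ
    set K := weakNormR (ENNReal.ofReal (p / (p - 1))) ω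
      ((cube c r).indicator fun x => (ω x)⁻¹) with hKdef
    have hb : 0 < 1 + r / ρ c := by
      have := div_pos hr (hρ0 c)
      linarith
    have hψ : 0 < psi ρ θ c r := Real.rpow_pos_of_pos hb _
    have hψq : psi ρ (q * θ) c r = psi ρ θ c r ^ q := by
      rw [psi, psi, ← Real.rpow_mul hb.le, mul_comm]
    have hR : 0 < r ^ n := pow_pos hr n
    have hAle : W ^ (1 / p) * K * (ENNReal.ofReal (r ^ n * psi ρ θ c r))⁻¹ ≤
        ApqR ρ θ 0 p p ω ω := by
      have : W ^ (1 / p) *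
          weakNormR (conjE p) ω ((cube c r).indicator fun x => (ω x)⁻¹) *
          ENNReal.ofReal ((r ^ n * psi ρ θ c r) ^ ((0 : ℝ) / n - 1)) ≤ ApqR ρ θ 0 p p ω ω :=
        le_iSup₂_of_le c r (le_iSup_of_le hr le_rfl)
      rwa [conjE, if_neg hp.ne', zero_div, zero_sub, Real.rpow_neg_one,
        ENNReal.ofReal_inv_of_pos (by positivity)] at this
    have hKt : K ≠ ∞ := by
      intro hK
      refine hA (top_le_iff.1 (le_of_eq_of_le ?_ hAle))
      rw [hK, ENNReal.mul_top, ENNReal.top_mul]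
      · simp
      · simp [hW0, hWt]
    have hint := lintegral_rpow_weight_le hω hQ hW0 (s := q / (q - 1)) (by positivity) hconj hKt
    rw [← hKdef, ← hW, ← hD] at hint
    refine le_trans ?_ (mul_le_mul_right (ENNReal.rpow_le_rpow hAle hq0.le) _)
    set R := ENNReal.ofReal (r ^ n) with hRdef
    set P := ENNReal.ofReal (psi ρ θ c r) with hPdef
    have hR0 : R ≠ 0 := by simpa [hRdef] using hR
    have hP0 : P ≠ 0 := by simpa [hPdef] using hψ
    have hexp : W * (W ^ (1 - q / (q - 1) / (p / (p - 1)))) ^ (q - 1) = W ^ (1 / p * q) := by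
      rw [← ENNReal.rpow_mul]
      nth_rw 1 [← ENNReal.rpow_one W]
      rw [← ENNReal.rpow_add _ _ hW0 hWt]
      congr 1
      field_simp
      ring
    have hRpow : R⁻¹ * R⁻¹ ^ (q - 1) = R⁻¹ ^ q := by
      nth_rw 1 [← ENNReal.rpow_one R⁻¹]
      rw [← ENNReal.rpow_add _ _ (by simp [hRdef]) (by simpa using hR0)]
      congr 1
      ring
    calc (ENNReal.ofReal (psi ρ (q * θ) c r))⁻¹ * (R⁻¹ * W) *
          (R⁻¹ * ∫⁻ y in cube c r, ENNReal.ofReal (ω y ^ (1 - q / (q - 1)))) ^ (q - 1)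
        ≤ (ENNReal.ofReal (psi ρ (q * θ) c r))⁻¹ * (R⁻¹ * W) *
          (R⁻¹ * (ENNReal.ofReal D * (K ^ (q / (q - 1)) *
            W ^ (1 - q / (q - 1) / (p / (p - 1)))))) ^ (q - 1) := by
          gcongr
      _ = (P⁻¹) ^ q * (R⁻¹ * W) *
          (R⁻¹ ^ (q - 1) * (ENNReal.ofReal (D ^ (q - 1)) * (K ^ q *
            (W ^ (1 - q / (q - 1) / (p / (p - 1)))) ^ (q - 1)))) := by
          rw [hψq, ← ENNReal.ofReal_rpow_of_pos hψ, ← ENNReal.inv_rpow,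
            ENNReal.mul_rpow_of_nonneg _ _ hq1.le, ENNReal.mul_rpow_of_nonneg _ _ hq1.le,
            ENNReal.mul_rpow_of_nonneg _ _ hq1.le, ENNReal.ofReal_rpow_of_pos hD0,
            ← ENNReal.rpow_mul K, div_mul_cancel₀ _ hq1.ne']
      _ = ENNReal.ofReal (D ^ (q - 1)) *
          ((W * (W ^ (1 - q / (q - 1) / (p / (p - 1)))) ^ (q - 1)) * K ^ q *
            ((R⁻¹ * R⁻¹ ^ (q - 1)) * P⁻¹ ^ q)) := by
          ring
      _ = ENNReal.ofReal (D ^ (q - 1)) *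
          (W ^ (1 / p) * K * (ENNReal.ofReal (r ^ n * psi ρ θ c r))⁻¹) ^ q := by
          rw [hexp, hRpow, ENNReal.ofReal_mul hR.le, ENNReal.mul_inv (Or.inl hR0)
            (Or.inl ofReal_ne_top), ENNReal.mul_rpow_of_nonneg _ _ hq0.le,
            ENNReal.mul_rpow_of_nonneg _ _ hq0.le, ENNReal.mul_rpow_of_nonneg _ _ hq0.le,
            ← ENNReal.rpow_mul]
  exact ⟨main, fun hA => (main.trans_lt (ENNReal.mul_lt_top ofReal_lt_top
    (ENNReal.rpow_lt_top_of_nonneg hq0.le hA))).ne⟩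
end
end

section
/- Let ρ be a critical radius function on ℝ^n and let μ, ν be weights. If μ ∈ A_∞^ρ and ν ∈ A_∞^ρ(μ), then μν ∈ A_∞^ρ; that is, there exist θ ≥ 0, ε > 0 and C > 0 such that for every cube Q and every measurable E ⊆ Q, (μν)(E)/(μν)(Q) ≤ C·ψ_θ(Q)·(|E|/|Q|)^ε. -/
open MeasureTheory ENNReal Set
noncomputable section

/-- If `μ ∈ A_∞^ρ` and `ν ∈ A_∞^ρ(μ)`, then `μν ∈ A_∞^ρ`. -/
theorem statement11 (n : ℕ) (ρ : Rn n → ℝ) (hρ : IsCriticalRadius ρ)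
    (μ ν : Rn n → ℝ) (hμw : IsWeight μ) (hνw : IsWeight ν)
    (hμ : IsAinfRho ρ μ) (hν : IsAinfRhoMu ρ μ ν) :
    IsAinfRho ρ (fun x => μ x * ν x) := by
  obtain ⟨C₀, N₀, -, -, hρpos, -⟩ := hρ
  obtain ⟨θ₁, hθ₁, δ, hδ, C₁, hC₁, hμ⟩ := hμ
  obtain ⟨θ₂, hθ₂, ε, hε, C₂, hC₂, hν⟩ := hν
  refine ⟨θ₂ + θ₁ * ε, by positivity, δ * ε, by positivity, C₂ * C₁ ^ ε, by positivity, ?_⟩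
  intro c r hr E hE hEm
  have hbase : 0 < 1 + r / ρ c := by have := hρpos c; positivity
  have hratio : wMeas μ E / wMeas μ (cube c r) ≤
      ENNReal.ofReal (C₁ * psi ρ θ₁ c r) * (volume E / ENNReal.ofReal (r ^ n)) ^ δ :=
    ENNReal.div_le_of_le_mul (hμ c r hr E hE hEm)
  have hconst : C₂ * C₁ ^ ε * psi ρ (θ₂ + θ₁ * ε) c r =
      C₂ * psi ρ θ₂ c r * (C₁ * psi ρ θ₁ c r) ^ ε := by
    unfold psi
    rw [Real.mul_rpow hC₁.le (by positivity), ← Real.rpow_mul hbase.le, Real.rpow_add hbase]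
    ring
  have hψ₁ : 0 < psi ρ θ₁ c r := Real.rpow_pos_of_pos hbase _
  have hψ₂ : 0 < psi ρ θ₂ c r := Real.rpow_pos_of_pos hbase _
  simp only [mul_comm (μ _) (ν _)]
  calc wMeas (fun x => ν x * μ x) E
      ≤ ENNReal.ofReal (C₂ * psi ρ θ₂ c r) *
        (wMeas μ E / wMeas μ (cube c r)) ^ ε * wMeas (fun x => ν x * μ x) (cube c r) :=
        hν c r hr E hE hEm
    _ ≤ ENNReal.ofReal (C₂ * psi ρ θ₂ c r) *
        (ENNReal.ofReal (C₁ * psi ρ θ₁ c r) * (volume E / ENNReal.ofReal (r ^ n)) ^ δ) ^ ε *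
          wMeas (fun x => ν x * μ x) (cube c r) := by gcongr
    _ = _ := by
        rw [ENNReal.mul_rpow_of_nonneg _ _ hε.le, ← ENNReal.rpow_mul, hconst,
          ENNReal.ofReal_rpow_of_pos (by positivity), ← mul_assoc,
          ← ENNReal.ofReal_mul (by positivity)]
end
end

section
/- Let ρ be a critical radius function on ℝ^n, let 1 < q, r < ∞ and θ₃, θ₄, θ₅ ≥ 0. Let μ̃ and ω̃ be weights with μ̃ ∈ A_q^{ρ,θ₃}, ω̃ ∈ A_r^{ρ,θ₄}, and ω̃ ∈ RH_∞^{ρ,θ₅} with constant C. Then μ̃ω̃ ∈ A_{q+r−1}^{ρ,θ₃+θ₄+θ₅}, and moreover [μ̃ω̃]_{A_{q+r−1}^{ρ,θ₃+θ₄+θ₅}} ≤ C·[μ̃]_{A_q^{ρ,θ₃}}·[ω̃]_{A_r^{ρ,θ₄}}. -/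
open MeasureTheory ENNReal Set
noncomputable section

/-- Additivity of `psi` in the exponent, at the level of `ENNReal.ofReal`. -/
theorem ofReal_psi_add {n : ℕ} {ρ : Rn n → ℝ} {c : Rn n} {s : ℝ} (h : 0 < 1 + s / ρ c)
    (θ σ : ℝ) :
    ENNReal.ofReal (psi ρ (θ + σ) c s) =
      ENNReal.ofReal (psi ρ θ c s) * ENNReal.ofReal (psi ρ σ c s) := by
  rw [psi, Real.rpow_add h, ENNReal.ofReal_mul (Real.rpow_nonneg h.le _), psi, psi]

/-- The mass of a product is at most the essential supremum of one factor times the mass of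
the other. -/
theorem wMeas_mul_le_essSup_mul {n : ℕ} {u v : Rn n → ℝ} (hu : IsWeight u)
    (S : Set (Rn n)) :
    wMeas (fun x => u x * v x) S ≤
      essSup (fun x => ENNReal.ofReal (v x)) (volume.restrict S) * wMeas u S := by
  rw [wMeas, wMeas,
    ← lintegral_const_mul'' _ hu.1.aestronglyMeasurable.aemeasurable.restrict.ennreal_ofReal]
  refine lintegral_mono_ae ?_
  filter_upwards [ae_restrict_of_ae hu.2,
    ENNReal.ae_le_essSup (μ := volume.restrict S) (fun x => ENNReal.ofReal (v x))]
    with x hx hle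
  rw [ENNReal.ofReal_mul hx.le, mul_comm]
  gcongr

/-- Hölder's inequality for the dual weights of a product. -/
theorem lintegral_dual_mul_rpow_le {n : ℕ} {u v : Rn n → ℝ} (hu : IsWeight u)
    (hv : IsWeight v) {q r : ℝ} (hq : 1 < q) (hr : 1 < r) (S : Set (Rn n)) :
    (∫⁻ y in S, ENNReal.ofReal ((u y * v y) ^ (1 - (q + r - 1) / (q + r - 1 - 1)))) ^
        (q + r - 1 - 1) ≤
      (∫⁻ y in S, ENNReal.ofReal (u y ^ (1 - q / (q - 1)))) ^ (q - 1) *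
        (∫⁻ y in S, ENNReal.ofReal (v y ^ (1 - r / (r - 1)))) ^ (r - 1) := by
  have ha : 0 < q - 1 := by linarith
  have hb : 0 < r - 1 := by linarith
  have hab : 0 < q + r - 1 - 1 := by linarith
  have key := ENNReal.lintegral_mul_norm_pow_le (μ := volume.restrict S)
    (f := fun y => ENNReal.ofReal (u y ^ (1 - q / (q - 1))))
    (g := fun y => ENNReal.ofReal (v y ^ (1 - r / (r - 1))))
    (hu.1.aestronglyMeasurable.aemeasurable.restrict.pow_const _).ennreal_ofReal
    (hv.1.aestronglyMeasurable.aemeasurable.restrict.pow_const _).ennreal_ofReal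
    (div_nonneg ha.le hab.le) (div_nonneg hb.le hab.le)
    (by field_simp; ring)
  have heq : ∫⁻ y in S, ENNReal.ofReal ((u y * v y) ^ (1 - (q + r - 1) / (q + r - 1 - 1))) =
      ∫⁻ y in S, ENNReal.ofReal (u y ^ (1 - q / (q - 1))) ^ ((q - 1) / (q + r - 1 - 1)) *
        ENNReal.ofReal (v y ^ (1 - r / (r - 1))) ^ ((r - 1) / (q + r - 1 - 1)) := by
    refine lintegral_congr_ae ?_
    filter_upwards [ae_restrict_of_ae hu.2, ae_restrict_of_ae hv.2] with y hy hy'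
    rw [ENNReal.ofReal_rpow_of_pos (by positivity), ENNReal.ofReal_rpow_of_pos (by positivity),
      ← ENNReal.ofReal_mul (by positivity), ← Real.rpow_mul hy.le, ← Real.rpow_mul hy'.le,
      Real.mul_rpow hy.le hy'.le]
    congr 3 <;> · field_simp; ring
  rw [heq]
  refine (ENNReal.rpow_le_rpow key hab.le).trans_eq ?_
  rw [ENNReal.mul_rpow_of_nonneg _ _ hab.le, ← ENNReal.rpow_mul, ← ENNReal.rpow_mul,
    div_mul_cancel₀ _ hab.ne', div_mul_cancel₀ _ hab.ne']

/-- If `μ̃ ∈ A_q^{ρ,θ₃}`, `ω̃ ∈ A_r^{ρ,θ₄}` and `ω̃ ∈ RH_∞^{ρ,θ₅}` with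
constant `C`, then `μ̃ω̃ ∈ A_{q+r-1}^{ρ,θ₃+θ₄+θ₅}` with
`[μ̃ω̃] ≤ C·[μ̃]_{A_q^{ρ,θ₃}}·[ω̃]_{A_r^{ρ,θ₄}}`. -/
theorem statement14 (n : ℕ) (ρ : Rn n → ℝ) (hρ : IsCriticalRadius ρ)
    (q r θ₃ θ₄ θ₅ : ℝ) (hq : 1 < q) (hr : 1 < r)
    (hθ₃ : 0 ≤ θ₃) (hθ₄ : 0 ≤ θ₄) (hθ₅ : 0 ≤ θ₅)
    (μt ωt : Rn n → ℝ) (hμw : IsWeight μt) (hωw : IsWeight ωt)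
    (hμ : ApC ρ θ₃ q μt ≠ ∞) (hω : ApC ρ θ₄ r ωt ≠ ∞)
    (C : ℝ) (hC : 0 < C) (hRH : IsRHinf ρ θ₅ ωt C) :
    ApC ρ (θ₃ + θ₄ + θ₅) (q + r - 1) (fun x => μt x * ωt x) ≤
        ENNReal.ofReal C * ApC ρ θ₃ q μt * ApC ρ θ₄ r ωt ∧
      ApC ρ (θ₃ + θ₄ + θ₅) (q + r - 1) (fun x => μt x * ωt x) ≠ ∞ := by
  obtain ⟨C₀, N₀, -, -, hρpos, -⟩ := hρ
  have hle : ApC ρ (θ₃ + θ₄ + θ₅) (q + r - 1) (fun x => μt x * ωt x) ≤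
      ENNReal.ofReal C * ApC ρ θ₃ q μt * ApC ρ θ₄ r ωt := by
    refine iSup_le fun c => iSup_le fun s => iSup_le fun hs => ?_
    have hpos : 0 < 1 + s / ρ c := by have := hρpos c; positivity
    have hψ (θ : ℝ) : ENNReal.ofReal (psi ρ θ c s) ≠ 0 := by
      simpa [psi] using Real.rpow_pos_of_pos hpos θ
    have h₁ : wMeas (fun x => μt x * ωt x) (cube c s) ≤ _ :=
      (wMeas_mul_le_essSup_mul hμw _).trans (mul_le_mul_left (hRH c s hs) _)
    have h₂ := lintegral_dual_mul_rpow_le hμw hωw hq hr (cube c s)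
    have hμle := le_iSup₂_of_le c s (le_iSup_of_le hs le_rfl) |>.trans_eq (ApC.eq_1 ρ θ₃ q μt).symm
    have hωle := le_iSup₂_of_le c s (le_iSup_of_le hs le_rfl) |>.trans_eq (ApC.eq_1 ρ θ₄ r ωt).symm
    refine le_trans ?_ (mul_le_mul' (mul_le_mul' le_rfl hμle) hωle)
    rw [ofReal_psi_add hpos, ofReal_psi_add hpos,
      ENNReal.mul_inv (.inr ofReal_ne_top) (.inr (hψ _)),
      ENNReal.mul_inv (.inr ofReal_ne_top) (.inr (hψ _)),
      ENNReal.mul_rpow_of_nonneg _ _ (by linarith : 0 ≤ q + r - 1 - 1),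
      ENNReal.mul_rpow_of_nonneg _ _ (by linarith : 0 ≤ q - 1),
      ENNReal.mul_rpow_of_nonneg _ _ (by linarith : 0 ≤ r - 1),
      show q + r - 1 - 1 = (q - 1) + (r - 1) by ring,
      ENNReal.rpow_add_of_nonneg _ _ (by linarith) (by linarith)]
    rw [show q + r - 1 - 1 = (q - 1) + (r - 1) by ring] at h₂
    rw [ENNReal.ofReal_mul hC.le] at h₁
    have h₅ := ENNReal.inv_mul_cancel (hψ θ₅) ofReal_ne_top
    refine (mul_le_mul' (mul_le_mul' le_rfl (mul_le_mul' le_rfl h₁))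
      (mul_le_mul' le_rfl h₂)).trans_eq ?_
    generalize ENNReal.ofReal (psi ρ θ₅ c s) = P at h₅ ⊢
    generalize P⁻¹ = P' at h₅ ⊢
    nth_rewrite 2 [← mul_one (ENNReal.ofReal C)]
    rw [← h₅]
    ring
  exact ⟨hle, ne_top_of_le_ne_top
    (ENNReal.mul_ne_top (ENNReal.mul_ne_top ofReal_ne_top hμ) hω) hle⟩
end
end
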